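/- Let n ≥ 2 and let Q(x₁,…,xₙ) = γ·(a₁^ρ·x₁^ρ + ⋯ + aₙ^ρ·xₙ^ρ)^{d/ρ} be a generalized ACMS (CES) production function on ℝⁿ₊, with γ, a₁,…,aₙ > 0 and nonzero real constants ρ and d. Then the Hessian determinant det(Q_ij) vanishes at every point of ℝⁿ₊ if and only if ρ = 1 or d = 1; moreover if ρ ≠ 1 and d ≠ 1 then det(Q_ij) is nonzero at every point of ℝⁿ₊. -/

import Mathlib

open Real

/-- Partial derivative of `f` in the `i`-th coordinate direction. -/
noncomputable def pd {n : ℕ} (i : Fin n) (f : (Fin n → ℝ) → ℝ) (x : Fin n → ℝ) : ℝ :=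
  fderiv ℝ f x (Pi.single i 1)

/-- Hessian matrix of second partial derivatives of `f` at `x`. -/
noncomputable def hess {n : ℕ} (f : (Fin n → ℝ) → ℝ) (x : Fin n → ℝ) :
    Matrix (Fin n) (Fin n) ℝ :=
  fun i j => pd i (pd j f) x

/-- Hessian determinant `det(f_ij)` of `f` at `x`. -/
noncomputable def hessDet {n : ℕ} (f : (Fin n → ℝ) → ℝ) (x : Fin n → ℝ) : ℝ :=
  (hess f x).det

/-- The open positive orthant `ℝⁿ₊`. -/
def posOrth (n : ℕ) : Set (Fin n → ℝ) := {x | ∀ i, 0 < x i}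

lemma hasFDerivAt_S {n : ℕ} (w : Fin n → ℝ) (ρ : ℝ) (x : Fin n → ℝ) (hx : ∀ i, 0 < x i) :
    HasFDerivAt (fun y : Fin n → ℝ => ∑ i, w i * y i ^ ρ)
      (∑ i, w i • ((ρ * x i ^ (ρ - 1)) • (ContinuousLinearMap.proj (R := ℝ) (φ := fun _ : Fin n => ℝ) i))) x := by
  apply HasFDerivAt.fun_sum
  intro i _
  apply HasFDerivAt.const_mul
  exact (hasFDerivAt_apply i x).rpow_const (Or.inl (hx i).ne')

lemma S_apply {n : ℕ} (w : Fin n → ℝ) (ρ : ℝ) (x : Fin n → ℝ) (j : Fin n) :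
    (∑ i, w i • ((ρ * x i ^ (ρ - 1)) • (ContinuousLinearMap.proj (R := ℝ) (φ := fun _ : Fin n => ℝ) i)))
      (Pi.single j 1) = ρ * (w j * x j ^ (ρ - 1)) := by
  simp [ContinuousLinearMap.sum_apply, Pi.single_apply]
  ring

lemma S_pos {n : ℕ} (hn : 2 ≤ n) (w : Fin n → ℝ) (hw : ∀ i, 0 < w i) (ρ : ℝ) (x : Fin n → ℝ)
    (hx : ∀ i, 0 < x i) : 0 < ∑ i, w i * x i ^ ρ := by
  apply Finset.sum_pos
  · intro i _
    exact mul_pos (hw i) (rpow_pos_of_pos (hx i) _)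
  · exact ⟨⟨0, by omega⟩, Finset.mem_univ _⟩

lemma pd_Q {n : ℕ} (hn : 2 ≤ n) (γ : ℝ) (w : Fin n → ℝ) (hw : ∀ i, 0 < w i)
    (ρ : ℝ) (hρ : ρ ≠ 0) (d : ℝ) (x : Fin n → ℝ) (hx : ∀ i, 0 < x i) (j : Fin n) :
    pd j (fun y => γ * (∑ i, w i * y i ^ ρ) ^ (d / ρ)) x =
      γ * d * ((∑ i, w i * x i ^ ρ) ^ (d / ρ - 1) * (w j * x j ^ (ρ - 1))) := by
  have h := ((hasFDerivAt_S w ρ x hx).rpow_const (p := d / ρ)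
    (Or.inl (S_pos hn w hw ρ x hx).ne')).const_mul γ
  unfold pd
  rw [h.fderiv, ContinuousLinearMap.smul_apply, ContinuousLinearMap.smul_apply, S_apply]
  simp only [smul_eq_mul]
  field_simp

lemma posOrth_open (n : ℕ) : IsOpen (posOrth n) := by
  have : posOrth n = ⋂ i, {x : Fin n → ℝ | 0 < x i} := by
    ext x; simp [posOrth]
  rw [this]
  exact isOpen_iInter_of_finite fun i => isOpen_lt continuous_const (continuous_apply i)

lemma hess_Q {n : ℕ} (hn : 2 ≤ n) (γ : ℝ) (w : Fin n → ℝ) (hw : ∀ i, 0 < w i)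
    (ρ : ℝ) (hρ : ρ ≠ 0) (d : ℝ) (x : Fin n → ℝ) (hx : ∀ i, 0 < x i) (i j : Fin n) :
    hess (fun y => γ * (∑ i, w i * y i ^ ρ) ^ (d / ρ)) x i j =
      γ * d * (∑ i, w i * x i ^ ρ) ^ (d / ρ - 2) *
        ((d - ρ) * (w i * x i ^ (ρ - 1)) * (w j * x j ^ (ρ - 1)) +
          if i = j then (ρ - 1) * (∑ i, w i * x i ^ ρ) * (w j * x j ^ (ρ - 1)) / x j else 0) := by
  have hS := S_pos hn w hw ρ x hx
  have he : pd j (fun y => γ * (∑ i, w i * y i ^ ρ) ^ (d / ρ)) =ᶠ[nhds x]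
      fun y => γ * d * ((∑ i, w i * y i ^ ρ) ^ (d / ρ - 1) * (w j * y j ^ (ρ - 1))) := by
    filter_upwards [(posOrth_open n).mem_nhds hx] with y hy
    exact pd_Q hn γ w hw ρ hρ d y hy j
  have h1 := (hasFDerivAt_S w ρ x hx).rpow_const (p := d / ρ - 1) (Or.inl hS.ne')
  have h2 : HasFDerivAt (fun y : Fin n → ℝ => w j * y j ^ (ρ - 1)) _ x :=
    ((hasFDerivAt_apply (𝕜 := ℝ) j x).rpow_const (p := ρ - 1)
      (Or.inl (hx j).ne')).const_mul (w j)
  have h := (h1.mul h2).const_mul (γ * d)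
  unfold hess
  rw [pd, he.fderiv_eq]
  erw [h.fderiv]
  simp only [ContinuousLinearMap.smul_apply, ContinuousLinearMap.add_apply, S_apply,
    ContinuousLinearMap.proj_apply, smul_eq_mul, Pi.single_apply]
  have e1 : (∑ i, w i * x i ^ ρ) ^ (d / ρ - 1) =
      (∑ i, w i * x i ^ ρ) ^ (d / ρ - 2) * (∑ i, w i * x i ^ ρ) := by
    rw [← rpow_add_one hS.ne']; congr 1; ring
  have e2 : x j ^ (ρ - 1 - 1) = x j ^ (ρ - 1) / x j := by
    rw [rpow_sub_one (hx j).ne' (ρ - 1)]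
  have e3 : d / ρ - 1 - 1 = d / ρ - 2 := by ring
  have hxj := (hx j).ne'
  rw [e3, e1, e2]
  by_cases hij : i = j
  · subst hij
    simp only [if_true]
    field_simp
    ring
  · simp only [hij, Ne.symm hij, if_false]
    field_simp
    ring

lemma mulVec_Q {n : ℕ} (hn : 2 ≤ n) (γ : ℝ) (w : Fin n → ℝ) (hw : ∀ i, 0 < w i)
    (ρ : ℝ) (hρ : ρ ≠ 0) (d : ℝ) (x : Fin n → ℝ) (hx : ∀ i, 0 < x i) (v : Fin n → ℝ)
    (i : Fin n) :
    ((hess (fun y => γ * (∑ i, w i * y i ^ ρ) ^ (d / ρ)) x).mulVec v) i =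
      γ * d * (∑ i, w i * x i ^ ρ) ^ (d / ρ - 2) * ((w i * x i ^ (ρ - 1)) / x i) *
        ((d - ρ) * x i * (∑ j, (w j * x j ^ (ρ - 1)) * v j) +
          (ρ - 1) * (∑ i, w i * x i ^ ρ) * v i) := by
  have hxi := (hx i).ne'
  simp only [Matrix.mulVec, dotProduct, hess_Q hn γ w hw ρ hρ d x hx]
  generalize (∑ i, w i * x i ^ ρ) = S
  generalize S ^ (d / ρ - 2) = T
  have : ∀ j, γ * d * T * ((d - ρ) * (w i * x i ^ (ρ - 1)) * (w j * x j ^ (ρ - 1)) +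
          if i = j then (ρ - 1) * S * (w j * x j ^ (ρ - 1)) / x j else 0) * v j
      = γ * d * T * (d - ρ) * (w i * x i ^ (ρ - 1)) * ((w j * x j ^ (ρ - 1)) * v j) +
        if i = j then γ * d * T * ((ρ - 1) * S * (w j * x j ^ (ρ - 1)) / x j) * v j else 0 := by
    intro j
    split_ifs <;> ring
  simp only [this, Finset.sum_add_distrib, ← Finset.mul_sum, Finset.sum_ite_eq, Finset.mem_univ,
    if_true]
  field_simp

lemma sum_ux {n : ℕ} (w : Fin n → ℝ) (ρ : ℝ) (x : Fin n → ℝ) (hx : ∀ i, 0 < x i) :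
    ∑ j, (w j * x j ^ (ρ - 1)) * x j = ∑ i, w i * x i ^ ρ := by
  apply Finset.sum_congr rfl
  intro j _
  rw [rpow_sub_one (hx j).ne']
  have := (hx j).ne'
  field_simp

lemma det_ne {n : ℕ} (hn : 2 ≤ n) (γ : ℝ) (hγ : 0 < γ) (w : Fin n → ℝ) (hw : ∀ i, 0 < w i)
    (ρ : ℝ) (hρ : ρ ≠ 0) (d : ℝ) (hd : d ≠ 0) (h1 : ρ ≠ 1) (h2 : d ≠ 1)
    (x : Fin n → ℝ) (hx : ∀ i, 0 < x i) :
    hessDet (fun y => γ * (∑ i, w i * y i ^ ρ) ^ (d / ρ)) x ≠ 0 := by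
  intro h
  obtain ⟨v, hv, hv0⟩ := Matrix.exists_mulVec_eq_zero_iff.mpr h
  have hS := S_pos hn w hw ρ x hx
  have key : ∀ i, (d - ρ) * x i * (∑ j, (w j * x j ^ (ρ - 1)) * v j) +
          (ρ - 1) * (∑ i, w i * x i ^ ρ) * v i = 0 := by
    intro i
    have := congrFun hv0 i
    rw [mulVec_Q hn γ w hw ρ hρ d x hx] at this
    have hc : γ * d * (∑ i, w i * x i ^ ρ) ^ (d / ρ - 2) * ((w i * x i ^ (ρ - 1)) / x i) ≠ 0 := by
      have := (rpow_pos_of_pos hS (d / ρ - 2)).ne'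
      have := (rpow_pos_of_pos (hx i) (ρ - 1)).ne'
      have := (hw i).ne'
      have := (hx i).ne'
      have := hγ.ne'
      positivity
    exact (mul_eq_zero.mp this).resolve_left hc
  have hs := sum_ux w ρ x hx
  generalize (∑ i, w i * x i ^ ρ) = S at *
  generalize ht : (∑ j, (w j * x j ^ (ρ - 1)) * v j) = t at *
  have hsum : (d - ρ) * t * S + (ρ - 1) * S * t = 0 := by
    have h0 : ∑ i, ((d - ρ) * t * ((w i * x i ^ (ρ - 1)) * x i) +
        (ρ - 1) * S * ((w i * x i ^ (ρ - 1)) * v i)) = 0 := by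
      apply Finset.sum_eq_zero
      intro i _
      linear_combination (w i * x i ^ (ρ - 1)) * key i
    rw [Finset.sum_add_distrib, ← Finset.mul_sum, ← Finset.mul_sum, hs, ht] at h0
    exact h0
  have ht0 : t = 0 := by
    have : (d - 1) * S * t = 0 := by linear_combination hsum
    simpa [sub_ne_zero.mpr h2, hS.ne'] using this
  apply hv
  ext i
  have := key i
  simpa [ht0, sub_ne_zero.mpr h1, hS.ne'] using this

lemma det_eq {n : ℕ} (hn : 2 ≤ n) (γ : ℝ) (w : Fin n → ℝ) (hw : ∀ i, 0 < w i)
    (ρ : ℝ) (hρ : ρ ≠ 0) (d : ℝ) (h1 : ρ = 1 ∨ d = 1)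
    (x : Fin n → ℝ) (hx : ∀ i, 0 < x i) :
    hessDet (fun y => γ * (∑ i, w i * y i ^ ρ) ^ (d / ρ)) x = 0 := by
  have hs := sum_ux w ρ x hx
  apply Matrix.exists_mulVec_eq_zero_iff.mp
  rcases h1 with h1 | h1
  · set p : Fin n := ⟨0, by omega⟩ with hp
    set q : Fin n := ⟨1, by omega⟩ with hq
    have hpq : p ≠ q := by simp [hp, hq]
    refine ⟨Pi.single p (w q * x q ^ (ρ - 1)) - Pi.single q (w p * x p ^ (ρ - 1)), ?_, ?_⟩
    · intro h
      have := congrFun h p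
      simp [hpq, (hw q).ne', (rpow_pos_of_pos (hx q) (ρ - 1)).ne'] at this
    · ext i
      rw [mulVec_Q hn γ w hw ρ hρ d x hx]
      have : ∑ j, (w j * x j ^ (ρ - 1)) * ((Pi.single p (w q * x q ^ (ρ - 1)) -
          Pi.single q (w p * x p ^ (ρ - 1)) : Fin n → ℝ) j) = 0 := by
        simp only [Pi.sub_apply, mul_sub, Finset.sum_sub_distrib, Pi.single_apply, mul_ite,
          mul_zero, Finset.sum_ite_eq', Finset.mem_univ, if_true]
        ring
      rw [this, h1]
      simp
  · refine ⟨x, ?_, ?_⟩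
    · intro h
      have := hx ⟨0, by omega⟩
      rw [h] at this
      simp at this
    · ext i
      rw [mulVec_Q hn γ w hw ρ hρ d x hx, hs, h1, Pi.zero_apply]
      ring

/-- For the generalized ACMS (CES) function
`Q(x) = γ·(∑ᵢ aᵢ^ρ·xᵢ^ρ)^{d/ρ}` on `ℝⁿ₊` (`n ≥ 2`, `γ, aᵢ > 0`, `ρ ≠ 0`, `d ≠ 0`),
the Hessian determinant `det(Q_ij)` vanishes at every point of `ℝⁿ₊` iff `ρ = 1` or
`d = 1`; moreover if `ρ ≠ 1` and `d ≠ 1` then `det(Q_ij)` is nonzero at every point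
of `ℝⁿ₊`. -/
theorem stmt_19 {n : ℕ} (hn : 2 ≤ n) (γ : ℝ) (hγ : 0 < γ)
    (a : Fin n → ℝ) (ha : ∀ i, 0 < a i)
    (ρ : ℝ) (hρ : ρ ≠ 0) (d : ℝ) (hd : d ≠ 0) :
    ((∀ x ∈ posOrth n,
        hessDet (fun y => γ * (∑ i, a i ^ ρ * y i ^ ρ) ^ (d / ρ)) x = 0) ↔
      (ρ = 1 ∨ d = 1)) ∧
    (ρ ≠ 1 → d ≠ 1 → ∀ x ∈ posOrth n,
        hessDet (fun y => γ * (∑ i, a i ^ ρ * y i ^ ρ) ^ (d / ρ)) x ≠ 0) := by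
  have hw : ∀ i, 0 < a i ^ ρ := fun i => rpow_pos_of_pos (ha i) ρ
  have hne : ρ ≠ 1 → d ≠ 1 → ∀ x ∈ posOrth n,
        hessDet (fun y => γ * (∑ i, a i ^ ρ * y i ^ ρ) ^ (d / ρ)) x ≠ 0 :=
    fun h1 h2 x hx => det_ne hn γ hγ (fun i => a i ^ ρ) hw ρ hρ d hd h1 h2 x hx
  refine ⟨⟨fun h => ?_, fun h x hx => det_eq hn γ (fun i => a i ^ ρ) hw ρ hρ d h x hx⟩, hne⟩
  by_contra hcon
  rw [not_or] at hcon
  have h1 : (fun _ => 1 : Fin n → ℝ) ∈ posOrth n := fun _ => one_pos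
  exact hne hcon.1 hcon.2 _ h1 (h _ h1)
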